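/- arXiv:2107.09994 — 2 statements merged into one kernel-verified Lean document; each statement's English description precedes it below -/
import Mathlib

section
/- Let k ≥ 1 and let G be a simple finite (2k−1)-vertex-connected graph. Then the total graph T(G) contains a clique minor of size Δ(G) + k, where Δ(G) is the maximum degree of G. -/
open SimpleGraph

/-- The total graph `T(G)` of a simple graph `G`: its vertices are the vertices and edges
of `G`, with two elements adjacent iff they are adjacent or incident in `G`. -/
def totalGraph {V : Type*} (G : SimpleGraph V) : SimpleGraph (V ⊕ G.edgeSet) :=
  SimpleGraph.fromRel fun x y =>
    match x, y with
    | Sum.inl u, Sum.inl v => G.Adj u v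
    | Sum.inl u, Sum.inr e => u ∈ (e : Sym2 V)
    | Sum.inr e, Sum.inl u => u ∈ (e : Sym2 V)
    | Sum.inr e, Sum.inr f => ∃ u, u ∈ (e : Sym2 V) ∧ u ∈ (f : Sym2 V)

/-- `cv`, `ce` form a total coloring of `G`: adjacent vertices get distinct colors, edges
sharing an endpoint get distinct colors, and every edge gets a color distinct from the colors
of both of its endpoints. -/
def IsTotalColoring {V : Type*} (G : SimpleGraph V) (cv : V → ℕ) (ce : Sym2 V → ℕ) : Prop :=
  (∀ ⦃u v⦄, G.Adj u v → cv u ≠ cv v) ∧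
  (∀ ⦃u v w⦄, G.Adj u v → G.Adj u w → v ≠ w → ce s(u, v) ≠ ce s(u, w)) ∧
  (∀ ⦃u v⦄, G.Adj u v → ce s(u, v) ≠ cv u ∧ ce s(u, v) ≠ cv v)

/-- The total chromatic number `χ''(G)`: the least `k` such that `G` has a total coloring
using colors `0, …, k-1`. -/
noncomputable def totalChromaticNumber {V : Type*} (G : SimpleGraph V) : ℕ :=
  sInf {k | ∃ cv ce, IsTotalColoring G cv ce ∧ (∀ v, cv v < k) ∧ ∀ e ∈ G.edgeSet, ce e < k}

/-- `H` has a minor isomorphic to `K`: there are pairwise disjoint nonempty branch sets,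
one for each vertex of `K`, each inducing a connected subgraph of `H`, with an edge of `H`
between the branch sets of any two adjacent vertices of `K`. -/
def HasMinor {W U : Type*} (H : SimpleGraph W) (K : SimpleGraph U) : Prop :=
  ∃ B : U → Set W,
    (∀ i, (B i).Nonempty) ∧
    (Pairwise fun i j => Disjoint (B i) (B j)) ∧
    (∀ i, (H.induce (B i)).Connected) ∧
    ∀ ⦃i j⦄, K.Adj i j → ∃ u ∈ B i, ∃ v ∈ B j, H.Adj u v

/-- `H` has a clique minor of order `t` (a `K_t`-minor): `t` pairwise disjoint nonempty
vertex subsets, each inducing a connected subgraph, with an edge between every pair. -/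
def HasCliqueMinor {W : Type*} (H : SimpleGraph W) (t : ℕ) : Prop :=
  ∃ B : Fin t → Set W,
    (∀ i, (B i).Nonempty) ∧
    (Pairwise fun i j => Disjoint (B i) (B j)) ∧
    (∀ i, (H.induce (B i)).Connected) ∧
    Pairwise fun i j => ∃ u ∈ B i, ∃ v ∈ B j, H.Adj u v

/-- The Hadwiger number `η(H)`: the largest `t` such that `H` has a `K_t`-minor. -/
noncomputable def hadwigerNumber {W : Type*} (H : SimpleGraph W) : ℕ :=
  sSup {t | HasCliqueMinor H t}

/-- A graph is `c`-vertex-connected if it has more than `c` vertices and deleting any set of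
fewer than `c` vertices leaves a connected graph. -/
def IsKConnected {V : Type*} [Fintype V] (c : ℕ) (G : SimpleGraph V) : Prop :=
  c < Fintype.card V ∧
    ∀ S : Finset V, S.card < c → (G.induce ((S : Set V)ᶜ)).Connected

/-- `G` is planar (Wagner's characterization): `G` has neither a `K₅`-minor nor a
`K₃,₃`-minor. -/
def IsPlanar {V : Type*} (G : SimpleGraph V) : Prop :=
  ¬ HasMinor G (⊤ : SimpleGraph (Fin 5)) ∧
  ¬ HasMinor G (completeBipartiteGraph (Fin 3) (Fin 3))

/-- `c` is a proper edge coloring of `G`: edges sharing an endpoint get distinct colors. -/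
def IsProperEdgeColoring {V : Type*} (G : SimpleGraph V) (c : Sym2 V → ℕ) : Prop :=
  ∀ ⦃u v w⦄, G.Adj u v → G.Adj u w → v ≠ w → c s(u, v) ≠ c s(u, w)

/-- The chromatic index `χ'(G)`: the least `k` such that `G` has a proper edge coloring
using colors `0, …, k-1`. -/
noncomputable def chromaticIndex {V : Type*} (G : SimpleGraph V) : ℕ :=
  sInf {k | ∃ c : Sym2 V → ℕ, IsProperEdgeColoring G c ∧ ∀ e ∈ G.edgeSet, c e < k}

/-- `G` is `k`-edge-choosable: for every assignment of a list of `k` colors to each edge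
there is a proper edge coloring choosing each edge's color from its list. -/
def EdgeChoosable {V : Type*} (G : SimpleGraph V) (k : ℕ) : Prop :=
  ∀ L : Sym2 V → Finset ℕ, (∀ e ∈ G.edgeSet, (L e).card = k) →
    ∃ c : Sym2 V → ℕ, IsProperEdgeColoring G c ∧ ∀ e ∈ G.edgeSet, c e ∈ L e

/-- The edge choosability `ch'(G)`: the least `k` such that `G` is `k`-edge-choosable. -/
noncomputable def edgeChoosability {V : Type*} (G : SimpleGraph V) : ℕ :=
  sInf {k | EdgeChoosable G k}

/-- The subdivision of `H`: every edge `uv` is replaced by a path `u – w_{uv} – v` through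
a new vertex `w_{uv}` corresponding to that edge. -/
def subdivision {V : Type*} (H : SimpleGraph V) : SimpleGraph (V ⊕ H.edgeSet) :=
  SimpleGraph.fromRel fun x y =>
    match x, y with
    | Sum.inl u, Sum.inr e => u ∈ (e : Sym2 V)
    | _, _ => False

/-- The square `G²` of `G`: two distinct vertices are adjacent iff their distance in `G`
is at most `2`, i.e. they are adjacent or have a common neighbour. -/
def squareGraph {V : Type*} (G : SimpleGraph V) : SimpleGraph V :=
  SimpleGraph.fromRel fun u v => G.Adj u v ∨ ∃ w, G.Adj u w ∧ G.Adj w v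

/-- If a set function `c` is antitone and supermodular, then color lists on the elements of `E`
satisfying a Rado-type bound can be shrunk to lists with at most one color each,
keeping the bound. -/
theorem exists_card_le_one_of_supermodular {α ι : Type*} [Fintype ι] [DecidableEq α]
    (E : Finset α) (c : Set α → ℕ) (hanti : Antitone c)
    (hsuper : ∀ A B, c A + c B ≤ c (A ∪ B) + c (A ∩ B)) (N : ℕ) (L : α → Finset ι)
    (hL : ∀ J ⊆ E, ∑ i, c {e | e ∈ J ∧ i ∈ L e} ≤ (E \ J).card + N) :
    ∃ L' : α → Finset ι, (∀ e ∈ E, (L' e).card ≤ 1) ∧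
      ∀ J ⊆ E, ∑ i, c {e | e ∈ J ∧ i ∈ L' e} ≤ (E \ J).card + N := by
  classical
  induction hn : ∑ e ∈ E, (L e).card using Nat.strong_induction_on generalizing L with
  | _ n ih =>
  by_cases hcard : ∀ e ∈ E, (L e).card ≤ 1
  · exact ⟨L, hcard, hL⟩
  push Not at hcard
  obtain ⟨e, he, hlt⟩ := hcard
  obtain ⟨i, hi, j, hj, hij⟩ := Finset.one_lt_card.mp hlt
  have key : ∀ t ∈ L e,
      (∀ J ⊆ E, ∑ i, c {x | x ∈ J ∧ i ∈ Function.update L e ((L e).erase t) x} ≤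
        (E \ J).card + N) →
      ∃ L' : α → Finset ι, (∀ e ∈ E, (L' e).card ≤ 1) ∧
        ∀ J ⊆ E, ∑ i, c {e | e ∈ J ∧ i ∈ L' e} ≤ (E \ J).card + N := by
    intro t ht h
    refine ih _ ?_ _ h rfl
    rw [← hn]
    refine Finset.sum_lt_sum (fun x _ => ?_) ⟨e, he, ?_⟩
    · by_cases hx : x = e
      · subst hx; simpa using Finset.card_le_card (Finset.erase_subset t (L x))
      · simp [hx]
    · simpa using Finset.card_erase_lt_of_mem ht
  have mem_of_fail : ∀ t, ∀ J ⊆ E,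
      (E \ J).card + N < ∑ i, c {x | x ∈ J ∧ i ∈ Function.update L e ((L e).erase t) x} →
      e ∈ J := by
    intro t J hJ h
    by_contra heJ
    refine absurd (hL J hJ) (not_le.mpr (h.trans_le (le_of_eq ?_)))
    refine Finset.sum_congr rfl fun s _ => congrArg c ?_
    ext x
    by_cases hx : x = e
    · subst hx; simp [heJ]
    · simp [hx]
  by_cases h1 : ∀ J ⊆ E,
      ∑ s, c {x | x ∈ J ∧ s ∈ Function.update L e ((L e).erase i) x} ≤ (E \ J).card + N
  · exact key i hi h1
  by_cases h2 : ∀ J ⊆ E,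
      ∑ s, c {x | x ∈ J ∧ s ∈ Function.update L e ((L e).erase j) x} ≤ (E \ J).card + N
  · exact key j hj h2
  exfalso
  push Not at h1 h2
  obtain ⟨J, hJ, hJc⟩ := h1
  obtain ⟨K, hK, hKc⟩ := h2
  have heJ := mem_of_fail i J hJ hJc
  have heK := mem_of_fail j K hK hKc
  have hU := hL (J ∪ K) (Finset.union_subset hJ hK)
  have hI := hL ((J ∩ K).erase e)
    ((Finset.erase_subset _ _).trans (Finset.inter_subset_left.trans hJ))
  have hsum : ∑ s, c {x | x ∈ J ∧ s ∈ Function.update L e ((L e).erase i) x} +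
      ∑ s, c {x | x ∈ K ∧ s ∈ Function.update L e ((L e).erase j) x} ≤
      ∑ s, c {x | x ∈ J ∪ K ∧ s ∈ L x} + ∑ s, c {x | x ∈ (J ∩ K).erase e ∧ s ∈ L x} := by
    rw [← Finset.sum_add_distrib, ← Finset.sum_add_distrib]
    refine Finset.sum_le_sum fun s _ => (hsuper _ _).trans (add_le_add (hanti ?_) (hanti ?_))
    · rintro x ⟨hx, hs⟩
      by_cases hxe : x = e
      · subst hxe
        by_cases hsi : s = i
        · right; subst hsi; simp [heK, hij, hs]
        · left; simp [heJ, hsi, hs]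
      · rcases Finset.mem_union.mp hx with h | h
        · left; simp [h, hxe, hs]
        · right; simp [h, hxe, hs]
    · rintro x ⟨hx, hs⟩
      simp only [Finset.mem_erase, Finset.mem_inter] at hx
      simp [hx, hs]
  have e1 := Finset.card_sdiff_add_card_eq_card hJ
  have e2 := Finset.card_sdiff_add_card_eq_card hK
  have e3 := Finset.card_sdiff_add_card_eq_card (Finset.union_subset hJ hK)
  have e4 := Finset.card_sdiff_add_card_eq_card
    ((Finset.erase_subset e _).trans (Finset.inter_subset_left.trans hJ) : (J ∩ K).erase e ⊆ E)
  have e5 := Finset.card_union_add_card_inter J K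
  have e6 := Finset.card_erase_add_one (Finset.mem_inter.mpr ⟨heJ, heK⟩)
  omega

/-- The functions on `W` taking equal values at the two ends of every pair in `A`. -/
def locallyConstant {W : Type*} (A : Set (Sym2 W)) : Submodule ℚ (W → ℚ) where
  carrier := {f | ∀ a b, s(a, b) ∈ A → f a = f b}
  add_mem' hf hg a b h := by simp [hf a b h, hg a b h]
  zero_mem' _ _ _ := rfl
  smul_mem' r f hf a b h := by simp [hf a b h]

theorem locallyConstant_antitone {W : Type*} :
    Antitone (locallyConstant : Set (Sym2 W) → Submodule ℚ (W → ℚ)) :=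
  fun _ _ h _ hf a b hab => hf a b (h hab)

theorem finrank_locallyConstant_supermodular {W : Type*} [Finite W] (A B : Set (Sym2 W)) :
    Module.finrank ℚ (locallyConstant A) + Module.finrank ℚ (locallyConstant B) ≤
      Module.finrank ℚ (locallyConstant (A ∪ B)) +
        Module.finrank ℚ (locallyConstant (A ∩ B)) := by
  rw [← Submodule.finrank_sup_add_finrank_inf_eq, add_comm]
  refine add_le_add (Submodule.finrank_mono ?_) (Submodule.finrank_mono ?_)
  · rintro f ⟨h1, h2⟩ a b (h | h)
    exacts [h1 a b h, h2 a b h]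
  · exact sup_le (locallyConstant_antitone Set.inter_subset_left)
      (locallyConstant_antitone Set.inter_subset_right)

theorem eq_of_reachable_of_mem_locallyConstant {W : Type*} {A : Set (Sym2 W)} {f : W → ℚ}
    (hf : f ∈ locallyConstant A) {a b : W} (h : (fromEdgeSet A).Reachable a b) : f a = f b := by
  obtain ⟨p⟩ := h
  induction p with
  | nil => rfl
  | cons h _ ih => exact (hf _ _ ((fromEdgeSet_adj A).mp h).1).trans ih

theorem finrank_locallyConstant_le {W : Type*} [Finite W] (A : Set (Sym2 W)) :
    Module.finrank ℚ (locallyConstant A) ≤ Nat.card (fromEdgeSet A).ConnectedComponent := by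
  have := Fintype.ofFinite (fromEdgeSet A).ConnectedComponent
  rw [Nat.card_eq_fintype_card, ← Module.finrank_fintype_fun_eq_card ℚ]
  refine (Submodule.finrank_mono ?_).trans (LinearMap.finrank_range_le
    (LinearMap.funLeft ℚ ℚ (fromEdgeSet A).connectedComponentMk))
  intro f hf
  refine ⟨fun C => f C.out, funext fun w => ?_⟩
  exact eq_of_reachable_of_mem_locallyConstant hf (ConnectedComponent.exact (Quot.out_eq _))

theorem one_le_finrank_locallyConstant {W : Type*} [Finite W] [Nonempty W] (A : Set (Sym2 W)) :
    1 ≤ Module.finrank ℚ (locallyConstant A) := by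
  have : Nontrivial (locallyConstant A) :=
    ⟨⟨⟨1, fun _ _ _ => rfl⟩, 0, fun h => by
      simpa using congrFun (congrArg Subtype.val h) (Classical.arbitrary W)⟩⟩
  exact Module.finrank_pos

theorem connected_of_finrank_locallyConstant_le_one {W : Type*} [Finite W] [Nonempty W]
    {A : Set (Sym2 W)} (h : Module.finrank ℚ (locallyConstant A) ≤ 1) :
    (fromEdgeSet A).Connected := by
  classical
  refine ⟨fun a b => ?_⟩
  by_contra hab
  let f : locallyConstant A := ⟨fun w => if (fromEdgeSet A).Reachable a w then 1 else 0, by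
    intro x y hxy
    by_cases hne : x = y
    · rw [hne]
    have : (fromEdgeSet A).Adj x y := (fromEdgeSet_adj A).mpr ⟨hxy, hne⟩
    have : (fromEdgeSet A).Reachable a x ↔ (fromEdgeSet A).Reachable a y :=
      ⟨fun h => h.trans this.reachable, fun h => h.trans this.symm.reachable⟩
    simp [this]⟩
  let g : locallyConstant A := ⟨1, fun _ _ _ => rfl⟩
  obtain ⟨v, hv⟩ := finrank_le_one_iff.mp h
  obtain ⟨r, hr⟩ := hv f
  obtain ⟨s, hs⟩ := hv g
  have fa : r * v.1 a = 1 := by simpa [f] using congrFun (congrArg Subtype.val hr) a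
  have fb : r * v.1 b = 0 := by simpa [f, hab] using congrFun (congrArg Subtype.val hr) b
  have gb : s * v.1 b = 1 := by simpa [g] using congrFun (congrArg Subtype.val hs) b
  rcases mul_eq_zero.mp fb with h | h <;> simp [h] at fa gb

/-- **Tree packing**: if every cut of `H` has at least `2 * m` edges, then `H` contains `m`
pairwise edge-disjoint connected spanning subgraphs. -/
theorem exists_edgeDisjoint_connected_of_cut {W : Type*} [Fintype W] [Nonempty W]
    (H : SimpleGraph W) (m : ℕ)
    (hcut : ∀ S : Set W, S.Nonempty → Sᶜ.Nonempty →
      2 * m ≤ {e ∈ H.edgeSet | ∃ a ∈ S, ∃ b ∉ S, e = s(a, b)}.ncard) :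
    ∃ T : Fin m → SimpleGraph W, (∀ i, T i ≤ H) ∧ (∀ i, (T i).Connected) ∧
      Pairwise fun i j => Disjoint (T i).edgeSet (T j).edgeSet := by
  classical
  have hbound : ∀ J ⊆ H.edgeFinset, ∑ i : Fin m, Module.finrank ℚ
      (locallyConstant {e | e ∈ J ∧ i ∈ (Finset.univ : Finset (Fin m))}) ≤
        (H.edgeFinset \ J).card + m := by
    intro J hJ
    have hset (i : Fin m) :
        {e | e ∈ J ∧ i ∈ (Finset.univ : Finset (Fin m))} = (J : Set (Sym2 W)) := by
      ext; simp
    rw [Finset.sum_congr rfl fun i _ =>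
        congrArg (fun A => Module.finrank ℚ (locallyConstant A)) (hset i),
      Finset.sum_const, Finset.card_univ, Fintype.card_fin, smul_eq_mul]
    set F := fromEdgeSet (J : Set (Sym2 W)) with hF
    have := Fintype.ofFinite F.ConnectedComponent
    have hle := finrank_locallyConstant_le (J : Set (Sym2 W))
    rw [← hF, Nat.card_eq_fintype_card] at hle
    rcases le_or_gt (Fintype.card F.ConnectedComponent) 1 with h1 | h1
    · nlinarith
    have hdouble := Finset.sum_card_bipartiteAbove_eq_sum_card_bipartiteBelow
      (s := (Finset.univ : Finset F.ConnectedComponent)) (t := H.edgeFinset \ J)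
      (fun C e => ∃ a ∈ C.supp, ∃ b ∉ C.supp, e = s(a, b))
    have hlow : Fintype.card F.ConnectedComponent * (2 * m) ≤
        ∑ C : F.ConnectedComponent, ((H.edgeFinset \ J).bipartiteAbove
          (fun C e => ∃ a ∈ C.supp, ∃ b ∉ C.supp, e = s(a, b)) C).card := by
      rw [← smul_eq_mul, ← Finset.card_univ]
      refine Finset.card_nsmul_le_sum _ _ _ fun C _ => ?_
      obtain ⟨D, hD⟩ := Fintype.exists_ne_of_one_lt_card h1 C
      refine (hcut C.supp C.nonempty_supp ?_).trans ?_
      · obtain ⟨d, hd⟩ := D.nonempty_supp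
        refine ⟨d, fun hc => hD ?_⟩
        rw [ConnectedComponent.mem_supp_iff] at hd hc
        exact hd.symm.trans hc
      · rw [← Set.ncard_coe_finset]
        refine Set.ncard_le_ncard ?_ (Finset.finite_toSet _)
        rintro e ⟨he, a, ha, b, hb, rfl⟩
        simp only [Finset.coe_bipartiteAbove, Set.mem_ofPred_eq, Finset.mem_sdiff,
          mem_edgeFinset]
        refine ⟨⟨he, fun hJe => hb ?_⟩, a, ha, b, hb, rfl⟩
        rw [ConnectedComponent.mem_supp_iff] at ha ⊢
        rw [← ha]
        refine ConnectedComponent.sound (Adj.reachable ?_)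
        exact (fromEdgeSet_adj _).mpr ⟨by simpa [Sym2.eq_swap] using hJe, (H.ne_of_adj he).symm⟩
    have hup : ∑ e ∈ H.edgeFinset \ J, ((Finset.univ : Finset F.ConnectedComponent).bipartiteBelow
          (fun C e => ∃ a ∈ C.supp, ∃ b ∉ C.supp, e = s(a, b)) e).card ≤
        (H.edgeFinset \ J).card * 2 := by
      rw [← smul_eq_mul]
      refine Finset.sum_le_card_nsmul _ _ _ fun e _ => ?_
      induction e with
      | _ x y =>
      refine (Finset.card_le_card (t := {F.connectedComponentMk x, F.connectedComponentMk y})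
        ?_).trans Finset.card_le_two
      intro C hC
      obtain ⟨a, ha, b, -, hab⟩ := (Finset.mem_bipartiteBelow _).mp hC |>.2
      rw [ConnectedComponent.mem_supp_iff] at ha
      rcases Sym2.eq_iff.mp hab with ⟨rfl, -⟩ | ⟨-, rfl⟩ <;> simp [ha]
    rw [hdouble] at hlow
    nlinarith [hlow.trans hup]
  obtain ⟨L, hL1, hL⟩ := exists_card_le_one_of_supermodular H.edgeFinset
    (fun A => Module.finrank ℚ (locallyConstant A))
    (fun _ _ h => Submodule.finrank_mono (locallyConstant_antitone h))
    finrank_locallyConstant_supermodular m (fun _ => (Finset.univ : Finset (Fin m))) hbound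
  have hsum := hL H.edgeFinset subset_rfl
  have hle (i : Fin m) :
      Module.finrank ℚ (locallyConstant {e | e ∈ H.edgeFinset ∧ i ∈ L e}) ≤ 1 := by
    by_contra! hi
    have : ∑ _j : Fin m, 1 <
        ∑ j, Module.finrank ℚ (locallyConstant {e | e ∈ H.edgeFinset ∧ j ∈ L e}) :=
      Finset.sum_lt_sum (fun j _ => one_le_finrank_locallyConstant _) ⟨i, Finset.mem_univ _, hi⟩
    simp at this hsum
    omega
  refine ⟨fun i => fromEdgeSet {e | e ∈ H.edgeFinset ∧ i ∈ L e}, fun i a b h => ?_,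
    fun i => connected_of_finrank_locallyConstant_le_one (hle i), fun i j hij => ?_⟩
  · simpa using ((fromEdgeSet_adj _).mp h).1.1
  · refine Set.disjoint_left.mpr fun e he he' => ?_
    rw [edgeSet_fromEdgeSet] at he he'
    exact hij (Finset.card_le_one.mp (hL1 e he.1.1) _ he.1.2 _ he'.1.2)

theorem totalGraph_inl_inl {V : Type*} {G : SimpleGraph V} {u v : V} :
    (totalGraph G).Adj (Sum.inl u) (Sum.inl v) ↔ G.Adj u v := by
  simp only [totalGraph, fromRel_adj, G.adj_comm v u, or_self, and_iff_right_iff_imp]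
  exact fun h h' => h.ne (Sum.inl_injective h')

theorem totalGraph_inl_inr {V : Type*} {G : SimpleGraph V} {u : V} {e : G.edgeSet} :
    (totalGraph G).Adj (Sum.inl u) (Sum.inr e) ↔ u ∈ (e : Sym2 V) := by
  simp [totalGraph]

theorem totalGraph_inr_inr {V : Type*} {G : SimpleGraph V} {e f : G.edgeSet} :
    (totalGraph G).Adj (Sum.inr e) (Sum.inr f) ↔
      e ≠ f ∧ ∃ u, u ∈ (e : Sym2 V) ∧ u ∈ (f : Sym2 V) := by
  simp only [totalGraph, fromRel_adj, ne_eq, Sum.inr.injEq, and_congr_right_iff]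
  intro _
  exact or_iff_left_of_imp fun ⟨u, h1, h2⟩ => ⟨u, h2, h1⟩

/-- The edges of a connected graph on at least two vertices, embedded into `G`,
induce a connected subgraph of the total graph. -/
theorem connected_induce_totalGraph_edges {V W : Type*} [Nontrivial W] {G : SimpleGraph V}
    {T : SimpleGraph W} (hT : T.Connected) (φ : T →g G) :
    ((totalGraph G).induce (Set.range fun e : T.edgeSet => Sum.inr (φ.mapEdgeSet e))).Connected := by
  set R := Set.range fun e : T.edgeSet =>
    (Sum.inr (φ.mapEdgeSet e) : V ⊕ G.edgeSet) with hR
  have hshare : ∀ (e f : T.edgeSet) (u : W), u ∈ (e : Sym2 W) → u ∈ (f : Sym2 W) →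
      ((totalGraph G).induce R).Reachable ⟨_, e, rfl⟩ ⟨_, f, rfl⟩ := by
    intro e f u he hf
    by_cases hef : φ.mapEdgeSet e = φ.mapEdgeSet f
    · simp only [hef]; exact Reachable.refl _
    · refine Adj.reachable ?_
      simp only [comap_adj, Function.Embedding.subtype_apply]
      exact totalGraph_inr_inr.mpr ⟨hef, φ u, Sym2.mem_map.mpr ⟨u, he, rfl⟩,
        Sym2.mem_map.mpr ⟨u, hf, rfl⟩⟩
  have hwalk : ∀ {u w : W} (_ : T.Walk u w) (e f : T.edgeSet), u ∈ (e : Sym2 W) →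
      w ∈ (f : Sym2 W) → ((totalGraph G).induce R).Reachable ⟨_, e, rfl⟩ ⟨_, f, rfl⟩ := by
    intro u w p
    induction p with
    | nil => exact fun e f he hf => hshare e f _ he hf
    | cons h p ih =>
      intro e f he hf
      exact (hshare e ⟨_, h⟩ _ he (Sym2.mem_mk_left _ _)).trans
        (ih ⟨_, h⟩ f (Sym2.mem_mk_right _ _) hf)
  have : Nonempty R := by
    obtain ⟨u⟩ := hT.nonempty
    obtain ⟨w, hw⟩ := hT.preconnected.exists_adj_of_nontrivial u
    exact ⟨⟨_, ⟨s(u, w), hw⟩, rfl⟩⟩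
  refine ⟨?_⟩
  rintro ⟨_, ⟨e, he⟩, rfl⟩ ⟨_, ⟨f, hf⟩, rfl⟩
  induction e with | _ a b =>
  induction f with | _ x y =>
  obtain ⟨p⟩ := hT.preconnected a x
  exact hwalk p ⟨_, he⟩ ⟨_, hf⟩ (Sym2.mem_mk_left _ _) (Sym2.mem_mk_left _ _)

theorem IsKConnected.connected {V : Type*} [Fintype V] {c : ℕ} {G : SimpleGraph V} (hc : 0 < c)
    (h : IsKConnected c G) : G.Connected := by
  have hG := h.2 ∅ (by simpa)
  have : Nonempty V := hG.nonempty.map Subtype.val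
  refine ⟨fun a b => ?_⟩
  simpa using (hG.preconnected ⟨a, by simp⟩ ⟨b, by simp⟩).map (Embedding.induce _).toHom

theorem IsKConnected.induce_compl_singleton {V : Type*} [Fintype V] [DecidableEq V] {c : ℕ}
    {G : SimpleGraph V} (h : IsKConnected (c + 1) G) (v : V) :
    IsKConnected c (G.induce ({v}ᶜ : Set V)) := by
  refine ⟨?_, fun S hS => ?_⟩
  · rw [Fintype.card_compl_set]
    have := h.1
    simp
    omega
  · have hS' := h.2 (insert v (S.map (Function.Embedding.subtype _)))
      ((Finset.card_insert_le _ _).trans_lt (by simpa using hS))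
    have hv : ∀ x : ((insert v (S.map (Function.Embedding.subtype _)) : Finset V) : Set V)ᶜ.Elem,
        x.1 ∈ ({v}ᶜ : Set V) := by
      rintro ⟨x, hx⟩
      simp only [Finset.coe_insert, Set.mem_compl_iff, Set.mem_insert_iff, not_or] at hx
      exact hx.1
    have hmem : ∀ x : ((insert v (S.map (Function.Embedding.subtype _)) : Finset V) : Set V)ᶜ.Elem,
        (⟨x.1, hv x⟩ : ({v}ᶜ : Set V)) ∈ ((S : Set _)ᶜ) := by
      rintro ⟨x, hx⟩ hxS
      refine hx ?_
      simp only [Finset.coe_insert]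
      exact Or.inr (Finset.mem_coe.mpr (Finset.mem_map.mpr ⟨_, hxS, rfl⟩))
    let φ : G.induce ((insert v (S.map (Function.Embedding.subtype _)) : Finset V) : Set V)ᶜ →g
        (G.induce ({v}ᶜ : Set V)).induce ((S : Set _)ᶜ) :=
      ⟨fun x => ⟨⟨x.1, hv x⟩, hmem x⟩, fun {a b} hab => hab⟩
    refine hS'.map φ ?_
    rintro ⟨⟨x, hx⟩, hxS⟩
    refine ⟨⟨x, ?_⟩, rfl⟩
    have hxv : x ≠ v := hx
    simpa [hxv] using hxS

/-- Every cut of a `c`-vertex-connected graph has at least `c` edges. -/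
theorem IsKConnected.le_ncard_cut {W : Type*} [Fintype W] {c : ℕ} {H : SimpleGraph W}
    (h : IsKConnected c H) (S : Set W) (hS : S.Nonempty) (hS' : Sᶜ.Nonempty) :
    c ≤ {e ∈ H.edgeSet | ∃ a ∈ S, ∃ b ∉ S, e = s(a, b)}.ncard := by
  classical
  set D := {e ∈ H.edgeSet | ∃ a ∈ S, ∃ b ∉ S, e = s(a, b)} with hD
  by_cases hadj : ∀ s ∈ S, ∀ t ∉ S, H.Adj s t
  · have hsub : (fun p : W × W => s(p.1, p.2)) '' (S ×ˢ Sᶜ) ⊆ D := by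
      rintro _ ⟨⟨s, t⟩, ⟨hs, ht⟩, rfl⟩
      exact ⟨hadj s hs t ht, s, hs, t, ht, rfl⟩
    have hinj : Set.InjOn (fun p : W × W => s(p.1, p.2)) (S ×ˢ Sᶜ) := by
      rintro ⟨s, t⟩ ⟨hs, ht⟩ ⟨s', t'⟩ ⟨hs', ht'⟩ heq
      rcases Sym2.eq_iff.mp heq with ⟨h1, h2⟩ | ⟨h1, -⟩
      · exact Prod.ext h1 h2
      · exact absurd (h1 ▸ hs) ht'
    have h1 := Set.ncard_le_ncard hsub (Set.toFinite _)
    rw [hinj.ncard_image, Set.ncard_prod] at h1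
    have h2 := Set.ncard_add_ncard_compl S
    rw [Nat.card_eq_fintype_card] at h2
    have h3 := (Set.ncard_pos (Set.toFinite S)).mpr hS
    have h4 := (Set.ncard_pos (Set.toFinite Sᶜ)).mpr hS'
    have h5 := h.1
    nlinarith
  · push Not at hadj
    obtain ⟨s, hs, t, ht, hst⟩ := hadj
    by_contra! hlt
    have hx : ∀ e ∈ D, ∃ x ∈ e, x ≠ s ∧ x ≠ t := by
      rintro _ ⟨he, a, ha, b, hb, rfl⟩
      by_cases has : a = s
      · subst has
        exact ⟨b, by simp, fun hbs => hb (hbs ▸ hs), fun hbt => hst (hbt ▸ he)⟩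
      · exact ⟨a, by simp, has, fun hat => ht (hat ▸ ha)⟩
    have : Nonempty W := ⟨s⟩
    choose! x hxe hxs hxt using hx
    have hcard : (D.toFinset.image x).card < c := by
      refine Finset.card_image_le.trans_lt ?_
      rwa [← Set.ncard_eq_toFinset_card']
    have hconn := h.2 _ hcard
    obtain ⟨p⟩ := hconn.preconnected
      ⟨s, by simpa using fun e he => hxs e he⟩ ⟨t, by simpa using fun e he => hxt e he⟩
    obtain ⟨d, -, hd1, hd2⟩ := p.exists_boundary_dart (Subtype.val ⁻¹' S) hs ht
    have hmem : s(d.fst.1, d.snd.1) ∈ D := ⟨d.adj, _, hd1, _, hd2, rfl⟩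
    have hX : x s(d.fst.1, d.snd.1) ∈ D.toFinset.image x :=
      Finset.mem_image_of_mem _ (by simpa using hmem)
    rcases Sym2.mem_iff.mp (hxe _ hmem) with heq | heq
    · exact d.fst.2 (by simpa [heq] using hX)
    · exact d.snd.2 (by simpa [heq] using hX)

/-- A clique minor whose branch sets are indexed by an arbitrary finite type. -/
theorem HasCliqueMinor.of_fintype {W ι : Type*} [Fintype ι] {H : SimpleGraph W} {t : ℕ}
    (ht : Fintype.card ι = t) (B : ι → Set W) (hconn : ∀ i, (H.induce (B i)).Connected)
    (hdisj : Pairwise fun i j => Disjoint (B i) (B j))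
    (hadj : Pairwise fun i j => ∃ u ∈ B i, ∃ v ∈ B j, H.Adj u v) : HasCliqueMinor H t := by
  let f := (Fintype.equivFinOfCardEq ht).symm
  exact ⟨B ∘ f, fun i => Set.nonempty_coe_sort.mp (hconn _).nonempty,
    fun i j hij => hdisj (f.injective.ne hij), fun i => hconn _,
    fun i j hij => hadj (f.injective.ne hij)⟩

/-- The branch sets of a clique minor of the total graph built from all vertices of `G`,
the single edges at `v`, and edge-disjoint subgraphs `T i` of `G - v`. -/
def totalGraphBranchSet {V : Type*} {G : SimpleGraph V} (v : V) {m : ℕ}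
    (T : Fin m → SimpleGraph ({v}ᶜ : Set V)) (φ : ∀ i, T i →g G) :
    Option (G.neighborSet v ⊕ Fin m) → Set (V ⊕ G.edgeSet)
  | none => Set.range Sum.inl
  | some (Sum.inl u) => {Sum.inr ⟨s(v, u.1), u.2⟩}
  | some (Sum.inr i) => Set.range fun e : (T i).edgeSet => Sum.inr ((φ i).mapEdgeSet e)

/-- if `k ≥ 1` and `G` is a `(2k-1)`-vertex-connected simple finite graph, then
the total graph `T(G)` contains a clique minor of size `Δ(G) + k`. -/
theorem totalGraph_hasCliqueMinor_of_connectivity {V : Type*} [Fintype V]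
    (G : SimpleGraph V) [DecidableRel G.Adj] (k : ℕ) (hk : 1 ≤ k)
    (hconn : IsKConnected (2 * k - 1) G) :
    HasCliqueMinor (totalGraph G) (G.maxDegree + k) := by
  classical
  obtain ⟨m, rfl⟩ : ∃ m, k = m + 1 := ⟨k - 1, by omega⟩
  rw [show 2 * (m + 1) - 1 = 2 * m + 1 by omega] at hconn
  have hG := hconn.connected (by omega)
  have := hG.nonempty
  obtain ⟨v, hv⟩ := G.exists_maximal_degree_vertex
  have hH := hconn.induce_compl_singleton v
  have hcardW := hH.1
  have : Nonempty ({v}ᶜ : Set V) := Fintype.card_pos_iff.mp (by omega)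
  obtain ⟨T, hTH, hT, hTd⟩ := exists_edgeDisjoint_connected_of_cut _ m hH.le_ncard_cut
  let φ (i : Fin m) : T i →g G := (Embedding.induce _).toHom.comp (Hom.ofLE (hTH i))
  have hnt (i : Fin m) : Nontrivial ({v}ᶜ : Set V) :=
    Fintype.one_lt_card_iff_nontrivial.mp (by have := i.pos; omega)
  have hinc (i : Fin m) (w : ({v}ᶜ : Set V)) : ∃ e : (T i).edgeSet, w ∈ (e : Sym2 _) := by
    have := hnt i
    obtain ⟨y, hy⟩ := (hT i).preconnected.exists_adj_of_nontrivial w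
    exact ⟨⟨_, hy⟩, Sym2.mem_mk_left _ _⟩
  have hmemφ (i : Fin m) (e : (T i).edgeSet) :
      ((φ i).mapEdgeSet e : Sym2 V) = (e : Sym2 ({v}ᶜ : Set V)).map Subtype.val := rfl
  have hstar (i : Fin m) (u : G.neighborSet v) (e : (T i).edgeSet) :
      (⟨s(v, u.1), u.2⟩ : G.edgeSet) ≠ (φ i).mapEdgeSet e := by
    intro h
    have h1 : v ∈ ((φ i).mapEdgeSet e : Sym2 V) := h ▸ Sym2.mem_mk_left _ _
    rw [hmemφ, Sym2.mem_map] at h1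
    obtain ⟨x, -, hx⟩ := h1
    exact x.2 hx
  have htree (i j : Fin m) (hij : i ≠ j) (e : (T i).edgeSet) (f : (T j).edgeSet) :
      (φ i).mapEdgeSet e ≠ (φ j).mapEdgeSet f := by
    intro h
    have h1 := congrArg Subtype.val h
    rw [hmemφ, hmemφ] at h1
    have h2 := Sym2.map.injective Subtype.val_injective h1
    exact Set.disjoint_left.mp (hTd hij) e.2 (h2 ▸ f.2)
  have hedge_inj (u w : G.neighborSet v)
      (h : (⟨s(v, u.1), u.2⟩ : G.edgeSet) = ⟨s(v, w.1), w.2⟩) : u = w :=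
    Subtype.ext (Sym2.congr_right.mp (congrArg Subtype.val h))
  refine HasCliqueMinor.of_fintype (ι := Option (G.neighborSet v ⊕ Fin m)) ?_
    (totalGraphBranchSet v T φ) ?_ ?_ ?_
  · rw [Fintype.card_option, Fintype.card_sum, Fintype.card_fin, hv, add_assoc,
      ← G.card_neighborSet_eq_degree v]
  · rintro (_ | u | i)
    · let ψ : G →g (totalGraph G).induce (Set.range Sum.inl) :=
        ⟨fun x => ⟨Sum.inl x, x, rfl⟩, fun h => totalGraph_inl_inl.mpr h⟩
      refine hG.map ψ ?_
      rintro ⟨_, x, rfl⟩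
      exact ⟨x, rfl⟩
    · have : Nonempty (totalGraphBranchSet v T φ (some (Sum.inl u))) := ⟨⟨_, rfl⟩⟩
      have : Subsingleton (totalGraphBranchSet v T φ (some (Sum.inl u))) :=
        Set.subsingleton_coe _ |>.mpr Set.subsingleton_singleton
      exact Connected.of_subsingleton
    · have := hnt i
      exact connected_induce_totalGraph_edges (hT i) (φ i)
  · rintro (_ | u | i) (_ | w | j) hij <;> refine Set.disjoint_left.mpr ?_
    · exact absurd rfl hij
    · rintro _ ⟨x, rfl⟩ h
      exact Sum.inl_ne_inr h
    · rintro _ ⟨x, rfl⟩ ⟨e, h⟩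
      exact Sum.inr_ne_inl h
    · rintro _ rfl ⟨x, h⟩
      exact Sum.inl_ne_inr h
    · rintro _ rfl h
      exact hij (by rw [hedge_inj u w (Sum.inr_injective h)])
    · rintro _ rfl ⟨e, h⟩
      exact hstar j u e (Sum.inr_injective h).symm
    · rintro _ ⟨e, rfl⟩ ⟨x, h⟩
      exact Sum.inl_ne_inr h
    · rintro _ ⟨e, rfl⟩ h
      exact hstar i w e (Sum.inr_injective h).symm
    · rintro _ ⟨e, rfl⟩ ⟨f, h⟩
      exact htree j i (by rintro rfl; exact hij rfl) f e (Sum.inr_injective h)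
  · have hverts (i : G.neighborSet v ⊕ Fin m) : ∃ x ∈ totalGraphBranchSet v T φ none,
        ∃ y ∈ totalGraphBranchSet v T φ (some i), (totalGraph G).Adj x y := by
      obtain u | i := i
      · exact ⟨_, ⟨v, rfl⟩, _, rfl, totalGraph_inl_inr.mpr (Sym2.mem_mk_left _ _)⟩
      · obtain ⟨e, he⟩ := hinc i (Classical.arbitrary _)
        exact ⟨_, ⟨_, rfl⟩, _, ⟨e, rfl⟩, totalGraph_inl_inr.mpr (Sym2.mem_map.mpr ⟨_, he, rfl⟩)⟩
    have hstarTree (u : G.neighborSet v) (i : Fin m) :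
        ∃ x ∈ totalGraphBranchSet v T φ (some (Sum.inl u)),
        ∃ y ∈ totalGraphBranchSet v T φ (some (Sum.inr i)), (totalGraph G).Adj x y := by
      obtain ⟨e, he⟩ := hinc i ⟨u.1, (G.ne_of_adj u.2).symm⟩
      exact ⟨_, rfl, _, ⟨e, rfl⟩, totalGraph_inr_inr.mpr
        ⟨hstar i u e, u.1, Sym2.mem_mk_right _ _, Sym2.mem_map.mpr ⟨_, he, rfl⟩⟩⟩
    have hsymm {i j} (h : ∃ x ∈ totalGraphBranchSet v T φ i,
        ∃ y ∈ totalGraphBranchSet v T φ j, (totalGraph G).Adj x y) :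
        ∃ x ∈ totalGraphBranchSet v T φ j,
        ∃ y ∈ totalGraphBranchSet v T φ i, (totalGraph G).Adj x y := by
      obtain ⟨x, hx, y, hy, h⟩ := h
      exact ⟨y, hy, x, hx, h.symm⟩
    rintro (_ | u | i) (_ | w | j) hij
    · exact absurd rfl hij
    · exact hverts _
    · exact hverts _
    · exact hsymm (hverts _)
    · exact ⟨_, rfl, _, rfl, totalGraph_inr_inr.mpr
        ⟨fun h => hij (by rw [hedge_inj u w h]), v, Sym2.mem_mk_left _ _, Sym2.mem_mk_left _ _⟩⟩
    · exact hstarTree _ _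
    · exact hsymm (hverts _)
    · exact hsymm (hstarTree _ _)
    · obtain ⟨e, he⟩ := hinc i (Classical.arbitrary _)
      obtain ⟨f, hf⟩ := hinc j (Classical.arbitrary _)
      exact ⟨_, ⟨e, rfl⟩, _, ⟨f, rfl⟩, totalGraph_inr_inr.mpr
        ⟨htree i j (by rintro rfl; exact hij rfl) e f, _, Sym2.mem_map.mpr ⟨_, he, rfl⟩,
          Sym2.mem_map.mpr ⟨_, hf, rfl⟩⟩⟩
end

section
/- Let H be a simple finite graph with maximum degree Δ that is (Δ+3)-total-critical, i.e., χ''(H) = Δ + 3 and χ''(H − e) ≤ Δ + 2 for every edge e of H. Then the total graph T(H) contains a clique minor of order Δ + 3. -/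
open SimpleGraph

/-- `cv`, `ce` form a total coloring of `G` with colors `0, …, k-1`. -/
def IsTotalColoringBelow {V : Type*} (G : SimpleGraph V) (k : ℕ) (cv : V → ℕ)
    (ce : Sym2 V → ℕ) : Prop :=
  IsTotalColoring G cv ce ∧ (∀ v, cv v < k) ∧ ∀ e ∈ G.edgeSet, ce e < k

/-- `G` has a total coloring with `k` colors. -/
def TotalColorable {V : Type*} (G : SimpleGraph V) (k : ℕ) : Prop :=
  ∃ cv ce, IsTotalColoringBelow G k cv ce

section Coloring

variable {V : Type*} {G H : SimpleGraph V} {k l : ℕ} {cv : V → ℕ} {ce : Sym2 V → ℕ}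

theorem IsTotalColoringBelow.mono (h : IsTotalColoringBelow H k cv ce) (hGH : G ≤ H)
    (hkl : k ≤ l) : IsTotalColoringBelow G l cv ce := by
  obtain ⟨⟨h1, h2, h3⟩, h4, h5⟩ := h
  refine ⟨⟨fun u v huv => h1 (hGH huv), fun u v w huv huw => h2 (hGH huv) (hGH huw),
    fun u v huv => h3 (hGH huv)⟩, fun v => (h4 v).trans_le hkl, fun e he => ?_⟩
  exact (h5 e (SimpleGraph.edgeSet_mono hGH he)).trans_le hkl

theorem TotalColorable.of_totalChromaticNumber_le (hG : TotalColorable G k)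
    (h : totalChromaticNumber G ≤ l) : TotalColorable G l := by
  obtain ⟨cv, ce, hc⟩ := hG
  obtain ⟨cv', ce', hc'⟩ := Nat.sInf_mem
    (s := {k | ∃ cv ce, IsTotalColoring G cv ce ∧ (∀ v, cv v < k) ∧ ∀ e ∈ G.edgeSet, ce e < k})
    ⟨k, cv, ce, hc⟩
  exact ⟨cv', ce', IsTotalColoringBelow.mono hc' le_rfl h⟩

theorem TotalColorable.totalChromaticNumber_le (hG : TotalColorable G k) :
    totalChromaticNumber G ≤ k :=
  Nat.sInf_le hG

/-- A single vertex may be recolored with any color not used by its neighbors and the edges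
at it. -/
theorem IsTotalColoringBelow.update_vertex [DecidableEq V] (h : IsTotalColoringBelow G k cv ce)
    {u : V} {b : ℕ} (hb : b < k) (hbu : ∀ w, G.Adj u w → b ≠ cv w ∧ b ≠ ce s(u, w)) :
    IsTotalColoringBelow G k (Function.update cv u b) ce := by
  obtain ⟨⟨h1, h2, h3⟩, h4, h5⟩ := h
  refine ⟨⟨fun p q hpq => ?_, h2, fun p q hpq => ?_⟩, fun p => ?_, h5⟩
  · have := h1 hpq
    have := hpq.ne
    have := hbu p
    have := hbu q
    have := hpq.symm
    grind [Function.update_apply]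
  · have := h3 hpq
    have := hpq.ne
    have := hbu p
    have := hbu q
    have := hpq.symm
    have : s(p, q) = s(q, p) := Sym2.eq_swap
    grind [Function.update_apply]
  · have := h4 p
    grind [Function.update_apply]

/-- A total coloring of `G - uv` extends to `G` by any color for `uv` not used at `u` or `v`,
provided that `u` and `v` have distinct colors. -/
theorem IsTotalColoringBelow.update_edge [DecidableEq V] {u v : V}
    (h : IsTotalColoringBelow (G.deleteEdges {s(u, v)}) k cv ce) {a : ℕ} (ha : a < k)
    (huv : cv u ≠ cv v) (hau : a ≠ cv u) (hav : a ≠ cv v)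
    (hu : ∀ w, G.Adj u w → w ≠ v → a ≠ ce s(u, w))
    (hv : ∀ w, G.Adj v w → w ≠ u → a ≠ ce s(v, w)) :
    IsTotalColoringBelow G k cv (Function.update ce s(u, v) a) := by
  obtain ⟨⟨h1, h2, h3⟩, h4, h5⟩ := h
  simp only [SimpleGraph.deleteEdges_adj, Set.mem_singleton_iff] at h1 h2 h3
  refine ⟨⟨fun p q hpq => ?_, fun p q r hpq hpr hqr => ?_, fun p q hpq => ?_⟩, h4, fun e he => ?_⟩
  · have := @h1 p q
    grind [Sym2.eq_iff]
  · have := @h2 p q r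
    have := hu q
    have := hu r
    have := hv q
    have := hv r
    have := hpq.ne
    have := hpr.ne
    grind [Function.update_apply, Sym2.eq_iff]
  · have := @h3 p q
    grind [Function.update_apply, Sym2.eq_iff]
  · have := h5 e
    simp only [SimpleGraph.edgeSet_deleteEdges, Set.mem_sdiff, Set.mem_singleton_iff] at this
    grind [Function.update_apply]

theorem exists_lt_notMem_of_card_lt {s : Finset ℕ} (hs : s.card < k) : ∃ a < k, a ∉ s := by
  obtain ⟨a, ha, has⟩ := Finset.exists_mem_notMem_of_card_lt_card
    (s := s) (t := Finset.range k) (by simpa using hs)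
  exact ⟨a, Finset.mem_range.1 ha, has⟩

section Degree

variable [Fintype V] [DecidableRel G.Adj]

theorem card_image_erase_neighborFinset [DecidableEq V] {u v : V} (huv : G.Adj u v)
    (f : V → ℕ) : (((G.neighborFinset u).erase v).image f).card + 1 ≤ G.degree u := by
  have h1 := Finset.card_image_le (s := (G.neighborFinset u).erase v) (f := f)
  have h2 := Finset.card_erase_add_one (s := G.neighborFinset u) (a := v) (by simpa using huv)
  rw [SimpleGraph.card_neighborFinset_eq_degree] at h2
  omega

theorem totalColorable_of_degree_add_le {u v : V} (huv : G.Adj u v)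
    (hdel : TotalColorable (G.deleteEdges {s(u, v)}) k)
    (hsum : G.degree u + G.degree v ≤ k) (hdeg : 2 * G.degree u < k) : TotalColorable G k := by
  classical
  obtain ⟨cv, ce, hc⟩ := hdel
  have hu := card_image_erase_neighborFinset huv (fun w => ce s(u, w))
  have hv := card_image_erase_neighborFinset huv.symm (fun w => ce s(v, w))
  obtain ⟨a, hak, ha⟩ := exists_lt_notMem_of_card_lt (k := k)
    (s := insert (cv v) (((G.neighborFinset u).erase v).image (fun w => ce s(u, w)) ∪
      ((G.neighborFinset v).erase u).image (fun w => ce s(v, w)))) (by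
        refine (Finset.card_insert_le _ _).trans_lt ?_
        have := Finset.card_union_le (((G.neighborFinset u).erase v).image (fun w => ce s(u, w)))
          (((G.neighborFinset v).erase u).image (fun w => ce s(v, w)))
        omega)
  obtain ⟨b, hbk, hb⟩ := exists_lt_notMem_of_card_lt (k := k)
    (s := insert a (((G.neighborFinset u).erase v).image (fun w => ce s(u, w)) ∪
      (G.neighborFinset u).image cv)) (by
        refine (Finset.card_insert_le _ _).trans_lt ?_
        have := Finset.card_union_le (((G.neighborFinset u).erase v).image (fun w => ce s(u, w)))
          ((G.neighborFinset u).image cv)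
        have := Finset.card_image_le (s := G.neighborFinset u) (f := cv)
        rw [SimpleGraph.card_neighborFinset_eq_degree] at this
        omega)
  simp only [Finset.mem_insert, Finset.mem_union, Finset.mem_image, Finset.mem_erase,
    SimpleGraph.mem_neighborFinset, not_or, not_exists, not_and] at ha hb
  have hc' := hc.update_vertex (u := u) hbk (fun w hw => by
    simp only [SimpleGraph.deleteEdges_adj, Set.mem_singleton_iff] at hw
    have := hb.2.1 w
    have := hb.2.2 w
    grind)
  have huv' := huv.ne
  refine ⟨_, _, hc'.update_edge hak ?_ ?_ ?_ ?_ ?_⟩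
  · have := hb.2.2 v huv
    grind [Function.update_apply]
  · grind [Function.update_apply]
  · grind [Function.update_apply]
  · intro w hw hwv h
    exact ha.2.1 w ⟨hwv, hw⟩ h.symm
  · intro w hw hwv h
    exact ha.2.2 w ⟨hwv, hw⟩ h.symm

theorem totalColorable_four_of_degree_le_two (hG : ∀ v, G.degree v ≤ 2) {u v w : V}
    (huv : G.Adj u v) (huw : G.Adj u w) (hvw : v ≠ w)
    (hdel : TotalColorable (G.deleteEdges {s(u, v)}) 4) : TotalColorable G 4 := by
  classical
  have hu : ∀ t, G.Adj u t → t = v ∨ t = w := by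
    intro t ht
    by_contra! h
    have h3 : ({v, w, t} : Finset V).card ≤ G.degree u := by
      rw [← SimpleGraph.card_neighborFinset_eq_degree]
      refine Finset.card_le_card fun s hs => ?_
      simp only [Finset.mem_insert, Finset.mem_singleton] at hs
      rcases hs with rfl | rfl | rfl <;> simpa
    rw [Finset.card_eq_three.2 ⟨v, w, t, hvw, h.1.symm, h.2.symm, rfl⟩] at h3
    have := hG u
    omega
  obtain ⟨cv, ce, hc⟩ := hdel
  have hv1 := card_image_erase_neighborFinset huv.symm (fun t => ce s(v, t))
  have hv2 := card_image_erase_neighborFinset huv.symm cv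
  have hw1 := card_image_erase_neighborFinset huw.symm (fun t => ce s(w, t))
  have hdv := hG v
  have hdw := hG w
  set Ev := ((G.neighborFinset v).erase u).image (fun t => ce s(v, t)) with hEv
  set Cv := ((G.neighborFinset v).erase u).image cv with hCv
  set Ew := ((G.neighborFinset w).erase u).image (fun t => ce s(w, t)) with hEw
  obtain ⟨r, hr4, hr⟩ := exists_lt_notMem_of_card_lt (k := 4) (s := Ev ∪ Cv ∪ Ew) (by
    have := Finset.card_union_le (Ev ∪ Cv) Ew
    have := Finset.card_union_le Ev Cv
    omega)
  obtain ⟨x, hx4, hxw, hxE, hxr⟩ : ∃ x < 4, x ≠ cv w ∧ x ∉ Ew ∧ (x = r ∨ cv w = r) := by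
    by_cases hwr : cv w = r
    · obtain ⟨x, hx4, hx⟩ := exists_lt_notMem_of_card_lt (k := 4) (s := insert r Ew)
        ((Finset.card_insert_le _ _).trans_lt (by omega))
      exact ⟨x, hx4, by grind⟩
    · exact ⟨r, hr4, by grind⟩
  obtain ⟨y, hy4, hy⟩ := exists_lt_notMem_of_card_lt (k := 4) (s := insert r (insert x Ev)) (by
    have := Finset.card_insert_le r (insert x Ev)
    have := Finset.card_insert_le x Ev
    omega)
  obtain ⟨z, hz4, hz⟩ : ∃ z < 4, z ∉ ({cv w, r, x, y} : Finset ℕ) := by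
    apply exists_lt_notMem_of_card_lt
    have h3 := Finset.card_le_three (a := cv w) (b := x) (c := y)
    have h3' := Finset.card_le_three (a := r) (b := x) (c := y)
    rcases hxr with rfl | rfl
    · rw [Finset.insert_idem]; omega
    · rw [Finset.insert_idem]; omega
  simp only [hEv, hCv, hEw, Finset.mem_insert, Finset.mem_union, Finset.mem_image,
    Finset.mem_erase, SimpleGraph.mem_neighborFinset, Finset.mem_singleton, not_or, not_exists,
    not_and] at hr hxE hy hz
  have h1 : IsTotalColoringBelow ((G.deleteEdges {s(u, v)}).deleteEdges {s(u, w)}) 4 cv ce :=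
    hc.mono (SimpleGraph.deleteEdges_le _) le_rfl
  have h2 := h1.update_vertex (u := v) hr4 (fun t ht => by
    simp only [SimpleGraph.deleteEdges_adj, Set.mem_singleton_iff] at ht
    have := hr.1.1 t
    have := hr.1.2 t
    grind [Sym2.eq_iff])
  have h3 := h2.update_vertex (u := u) hz4 (fun t ht => by
    simp only [SimpleGraph.deleteEdges_adj, Set.mem_singleton_iff] at ht
    have := hu t
    grind)
  have hnuv := huv.ne
  have hnuw := huw.ne
  have h4 := h3.update_edge (a := x) hx4 (by grind [Function.update_apply])
    (by grind [Function.update_apply]) (by grind [Function.update_apply])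
    (fun t ht htw => by
      simp only [SimpleGraph.deleteEdges_adj, Set.mem_singleton_iff] at ht
      have := hu t
      grind)
    (fun t ht htu => by
      simp only [SimpleGraph.deleteEdges_adj, Set.mem_singleton_iff] at ht
      have := hxE t
      grind)
  refine ⟨_, _, h4.update_edge (a := y) hy4 (by grind [Function.update_apply])
    (by grind [Function.update_apply]) (by grind [Function.update_apply])
    (fun t ht htv => ?_) (fun t ht htu => ?_)⟩
  · have := hu t
    grind [Function.update_apply]
  · have := hy.2.2 t
    grind [Function.update_apply, Sym2.eq_iff]

end Degree

/-- Colors below `k` can be permuted so as to send `c` to `d` and to move `Q` off `P`. -/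
theorem exists_injective_forall_notMem {P Q : Finset ℕ} {c d : ℕ} (hQ : ∀ q ∈ Q, q < k)
    (hc : c < k) (hd : d < k) (hcQ : c ∉ Q) (hPQ : P.card + Q.card < k) :
    ∃ f : ℕ → ℕ, Function.Injective f ∧ (∀ n < k, f n < k) ∧ f c = d ∧ ∀ q ∈ Q, f q ∉ P := by
  classical
  have hcard : Q.card ≤ (Finset.range k \ insert d P).card := by
    have h1 := Finset.le_card_sdiff (insert d P) (Finset.range k)
    have h2 := Finset.card_insert_le d P
    simp only [Finset.card_range] at h1
    omega
  obtain ⟨R, hR, hRQ⟩ := Finset.exists_subset_card_eq hcard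
  have hR' : ∀ r ∈ R, r < k ∧ r ≠ d ∧ r ∉ P := by
    intro r hr
    have := hR hr
    simp only [Finset.mem_sdiff, Finset.mem_range, Finset.mem_insert, not_or] at this
    exact this
  have hfin : Fintype.card {x : Fin k // x.1 ∈ Q} = Fintype.card {x : Fin k // x.1 ∈ R} := by
    have key : ∀ S : Finset ℕ, (∀ s ∈ S, s < k) →
        Fintype.card {x : Fin k // x.1 ∈ S} = S.card := by
      intro S hS
      rw [← Fintype.card_coe]
      exact Fintype.card_congr
        ⟨fun x => ⟨x.1.1, x.2⟩, fun s => ⟨⟨s.1, hS s.1 s.2⟩, s.2⟩, fun _ => rfl, fun _ => rfl⟩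
    rw [key Q hQ, key R (fun r hr => (hR' r hr).1), hRQ]
  let e := Fintype.equivOfCardEq hfin
  let τ : Equiv.Perm (Fin k) := e.extendSubtype
  have hτ : ∀ q : Fin k, q.1 ∈ Q → (τ q).1 ∈ R := fun q hq => e.extendSubtype_mem q hq
  have hτc : (τ ⟨c, hc⟩).1 ∉ R := e.extendSubtype_not_mem ⟨c, hc⟩ hcQ
  let σ : Equiv.Perm (Fin k) := τ.trans (Equiv.swap (τ ⟨c, hc⟩) ⟨d, hd⟩)
  refine ⟨fun n => if h : n < k then (σ ⟨n, h⟩).1 else n, ?_, ?_, ?_, ?_⟩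
  · intro m n hmn
    by_cases hm : m < k <;> by_cases hn : n < k <;> simp only [hm, hn, dite_true, dite_false] at hmn
    · simpa using σ.injective (Fin.ext hmn)
    · have := (σ ⟨m, hm⟩).2
      omega
    · have := (σ ⟨n, hn⟩).2
      omega
    · exact hmn
  · intro n hn
    simp [hn]
  · simp [hc, σ]
  · intro q hq
    have h1 := hτ ⟨q, hQ q hq⟩ hq
    have h2 : Equiv.swap (τ ⟨c, hc⟩) ⟨d, hd⟩ (τ ⟨q, hQ q hq⟩) = τ ⟨q, hQ q hq⟩ := by
      apply Equiv.swap_apply_of_ne_of_ne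
      · intro h
        rw [h] at h1
        exact hτc h1
      · intro h
        rw [h] at h1
        exact (hR' d h1).2.1 rfl
    simp only [hQ q hq, dite_true, σ, Equiv.trans_apply, h2]
    exact (hR' _ h1).2.2

/-- If `x` separates `A` from the rest of `G`, total colorings of the two sides combine to one
of `G`. -/
theorem totalColorable_of_cut_vertex [Fintype V] [DecidableRel G.Adj] {x : V} {A : Set V}
    (hxA : x ∉ A) (hA : ∀ a b, a ∈ A → G.Adj a b → b ∈ A ∨ b = x) (hdeg : G.degree x < k)
    (hcolA : TotalColorable (G.deleteEdges {e | ¬∃ a ∈ A, a ∈ e}) k)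
    (hcolB : TotalColorable (G.deleteEdges {e | ∃ a ∈ A, a ∈ e}) k) : TotalColorable G k := by
  classical
  obtain ⟨cv₁, ce₁, ⟨h1, h2, h3⟩, h4, h5⟩ := hcolA
  obtain ⟨cv₂, ce₂, ⟨g1, g2, g3⟩, g4, g5⟩ := hcolB
  have hmem : ∀ p q, (∃ a ∈ A, a ∈ s(p, q)) ↔ (p ∈ A ∨ q ∈ A) := by
    intro p q
    simp only [Sym2.mem_iff]
    grind
  simp only [SimpleGraph.deleteEdges_adj, Set.mem_ofPred_eq, hmem, not_not,
    SimpleGraph.edgeSet_deleteEdges, Set.mem_sdiff] at h1 h2 h3 h5 g1 g2 g3 g5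
  obtain ⟨f, hf, hfk, hfx, hfQ⟩ := exists_injective_forall_notMem (k := k)
    (P := ((G.neighborFinset x).filter (· ∈ A)).image (fun w => ce₁ s(x, w)))
    (Q := ((G.neighborFinset x).filter (· ∉ A)).image (fun w => ce₂ s(x, w)))
    (c := cv₂ x) (d := cv₁ x) (by
      intro q hq
      simp only [Finset.mem_image, Finset.mem_filter, SimpleGraph.mem_neighborFinset] at hq
      obtain ⟨w, ⟨hw, hwA⟩, rfl⟩ := hq
      refine g5 _ ⟨hw, ?_⟩
      rw [hmem]
      tauto) (g4 x) (h4 x) (by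
      intro hq
      simp only [Finset.mem_image, Finset.mem_filter, SimpleGraph.mem_neighborFinset] at hq
      obtain ⟨w, ⟨hw, hwA⟩, h⟩ := hq
      exact (g3 ⟨hw, by tauto⟩).1 h) (by
      have h1 := Finset.card_image_le (s := (G.neighborFinset x).filter (· ∈ A))
        (f := fun w => ce₁ s(x, w))
      have h2 := Finset.card_image_le (s := (G.neighborFinset x).filter (· ∉ A))
        (f := fun w => ce₂ s(x, w))
      have h3 := Finset.card_filter_add_card_filter_not (s := G.neighborFinset x) (· ∈ A)
      rw [SimpleGraph.card_neighborFinset_eq_degree] at h3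
      exact (Nat.add_le_add h1 h2).trans_lt (h3 ▸ hdeg))
  have hfPQ : ∀ p q, G.Adj x p → G.Adj x q → p ∈ A → q ∉ A →
      ce₁ s(x, p) ≠ f (ce₂ s(x, q)) := by
    intro p q hp hq hpA hqA h
    refine hfQ (ce₂ s(x, q)) (Finset.mem_image_of_mem (fun w => ce₂ s(x, w))
      (by simp [hq, hqA])) ?_
    rw [← h]
    exact Finset.mem_image_of_mem (fun w => ce₁ s(x, w)) (by simp [hp, hpA])
  clear hfQ
  have hAx : ∀ p q, G.Adj p q → p ∉ A → q ∈ A → p = x := by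
    intro p q hpq hp hq
    exact (hA q p hq hpq.symm).resolve_left hp
  refine ⟨fun v => if v ∈ A then cv₁ v else f (cv₂ v),
    fun e => if ∃ a ∈ A, a ∈ e then ce₁ e else f (ce₂ e),
    ⟨fun p q hpq => ?_, fun p q r hpq hpr hqr => ?_, fun p q hpq => ?_⟩, fun p => ?_,
    fun e he => ?_⟩
  · by_cases hp : p ∈ A <;> by_cases hq : q ∈ A <;> simp only [hp, hq, if_true, if_false]
    · exact h1 ⟨hpq, Or.inl hp⟩
    · obtain rfl := hAx q p hpq.symm hq hp
      exact hfx ▸ h1 ⟨hpq, Or.inl hp⟩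
    · obtain rfl := hAx p q hpq hp hq
      exact hfx ▸ h1 ⟨hpq, Or.inr hq⟩
    · exact hf.ne (g1 ⟨hpq, by tauto⟩)
  · simp only [hmem]
    by_cases hp : p ∈ A
    · simp only [hp, true_or, if_true]
      exact h2 ⟨hpq, Or.inl hp⟩ ⟨hpr, Or.inl hp⟩ hqr
    by_cases hq : q ∈ A <;> by_cases hr : r ∈ A <;>
      simp only [hp, hq, hr, or_true, or_false, if_true, if_false]
    · exact h2 ⟨hpq, Or.inr hq⟩ ⟨hpr, Or.inr hr⟩ hqr
    · obtain rfl := hAx p q hpq hp hq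
      exact hfPQ q r hpq hpr hq hr
    · obtain rfl := hAx p r hpr hp hr
      exact (hfPQ r q hpr hpq hr hq).symm
    · exact hf.ne (g2 ⟨hpq, by tauto⟩ ⟨hpr, by tauto⟩ hqr)
  · simp only [hmem]
    by_cases hp : p ∈ A <;> by_cases hq : q ∈ A <;>
      simp only [hp, hq, or_true, or_false, if_true, if_false]
    · exact h3 ⟨hpq, Or.inl hp⟩
    · obtain rfl := hAx q p hpq.symm hq hp
      exact hfx ▸ h3 ⟨hpq, Or.inl hp⟩
    · obtain rfl := hAx p q hpq hp hq
      exact hfx ▸ h3 ⟨hpq, Or.inr hq⟩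
    · have := g3 ⟨hpq, by tauto⟩
      exact ⟨hf.ne this.1, hf.ne this.2⟩
  · beta_reduce
    split_ifs
    exacts [h4 p, hfk _ (g4 p)]
  · beta_reduce
    split_ifs with h
    exacts [h5 e ⟨he, h⟩, hfk _ (g5 e ⟨he, h⟩)]

end Coloring

section Minor

variable {V W : Type*}

theorem induce_connected_iff {G : SimpleGraph V} {S : Set V} :
    (G.induce S).Connected ↔ S.Nonempty ∧ ∀ A ⊆ S, A.Nonempty →
      (∀ a ∈ A, ∀ b ∈ S, G.Adj a b → b ∈ A) → S ⊆ A := by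
  constructor
  · intro h
    refine ⟨Set.nonempty_coe_sort.1 h.nonempty, fun A hAS ⟨a, ha⟩ hA => ?_⟩
    have key : ∀ (p q : S), (G.induce S).Walk p q → p.1 ∈ A → q.1 ∈ A := by
      intro p q w
      induction w with
      | nil => exact id
      | cons hadj _ ih => exact fun hp => ih (hA _ hp _ (Subtype.prop _) hadj)
    intro s hs
    obtain ⟨w⟩ := h.preconnected ⟨a, hAS ha⟩ ⟨s, hs⟩
    exact key _ _ w ha
  · rintro ⟨⟨u, hu⟩, h⟩
    have hreach := h {v | ∃ hv : v ∈ S, (G.induce S).Reachable ⟨u, hu⟩ ⟨v, hv⟩}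
      (fun v hv => hv.1) ⟨u, hu, .refl _⟩ (by
        rintro a ⟨ha, hau⟩ b hb hab
        exact ⟨hb, hau.trans (SimpleGraph.Adj.reachable (G := G.induce S)
          (u := ⟨a, ha⟩) (v := ⟨b, hb⟩) hab)⟩)
    rw [SimpleGraph.connected_iff_exists_forall_reachable]
    exact ⟨⟨u, hu⟩, fun v => (hreach v.2).2⟩

/-- In a graph without cut vertices (up to isolated vertices), every vertex `x` of degree at
least two has a neighbor `y` such that the non-isolated vertices other than `x` and `y` induce
a connected graph. -/
theorem exists_adj_induce_connected [Finite V] {G : SimpleGraph V}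
    (hcut : ∀ (x : V) (A : Set V), x ∉ A → (∀ a b, a ∈ A → G.Adj a b → b ∈ A ∨ b = x) →
      (∃ a ∈ A, ∃ b, G.Adj a b) → ∀ a b, G.Adj a b → a ∈ A ∨ b ∈ A)
    {x y₁ y₂ : V} (hy₁ : G.Adj x y₁) (hy₂ : G.Adj x y₂) (hy : y₁ ≠ y₂) :
    ∃ y, G.Adj x y ∧ (G.induce {v | v ≠ x ∧ v ≠ y ∧ ∃ w, G.Adj v w}).Connected := by
  obtain ⟨C, ⟨y, hxy, hCx, hCy, hC, hCiso⟩, hmax⟩ := Set.Finite.exists_maximal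
    (Set.toFinite {C : Set V | ∃ y, G.Adj x y ∧ x ∉ C ∧ y ∉ C ∧ (G.induce C).Connected ∧
      ∀ c ∈ C, ∃ w, G.Adj c w})
    ⟨{y₂}, y₁, hy₁, by simpa using hy₂.ne, by simpa using hy,
      induce_connected_iff.2 ⟨Set.singleton_nonempty _, fun A hA hne _ =>
        (Set.Nonempty.subset_singleton_iff hne).1 hA ▸ subset_rfl⟩,
      by rintro _ rfl; exact ⟨x, hy₂.symm⟩⟩
  have hext : ∀ v, (∃ c ∈ C, G.Adj c v) → (G.induce (insert v C)).Connected := by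
    rintro v ⟨c, hcC, hcv⟩
    obtain ⟨hCne, hC⟩ := induce_connected_iff.1 hC
    refine induce_connected_iff.2 ⟨Set.insert_nonempty _ _, fun A hA hAne hcl => ?_⟩
    have hAC : C ⊆ A := by
      have hne : (A ∩ C).Nonempty := by
        obtain ⟨a, ha⟩ := hAne
        rcases hA ha with rfl | haC
        · exact ⟨c, hcl _ ha c (Or.inr hcC) hcv.symm, hcC⟩
        · exact ⟨a, ha, haC⟩
      exact (hC (A ∩ C) Set.inter_subset_right hne fun a ha b hb hab =>
        ⟨hcl a ha.1 b (Or.inr hb) hab, hb⟩).trans Set.inter_subset_left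
    exact Set.insert_subset (hcl c (hAC hcC) v (Or.inl rfl) hcv) hAC
  have hclosed : ∀ c v, c ∈ C → G.Adj c v → v ≠ x → v ≠ y → v ∈ C := by
    intro c v hc hcv hvx hvy
    refine hmax (y := insert v C) ⟨y, hxy, ?_, ?_, hext v ⟨c, hc, hcv⟩, ?_⟩
      (Set.subset_insert _ _) (Set.mem_insert _ _)
    · simp [hCx, hvx.symm]
    · simp [hCy, hvy.symm]
    · rintro d (rfl | hd)
      exacts [⟨c, hcv.symm⟩, hCiso d hd]
  obtain ⟨c₀, hc₀⟩ : C.Nonempty := (induce_connected_iff.1 hC).1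
  refine ⟨y, hxy, ?_⟩
  suffices h : {v | v ≠ x ∧ v ≠ y ∧ ∃ w, G.Adj v w} = C by rwa [h]
  refine Set.Subset.antisymm ?_ fun c hc =>
    ⟨ne_of_mem_of_not_mem hc hCx, ne_of_mem_of_not_mem hc hCy, hCiso c hc⟩
  rintro d ⟨hdx, hdy, hd⟩
  by_contra hdC
  obtain ⟨y', hxy', hy'y, hy'C⟩ : ∃ y', G.Adj x y' ∧ y' ≠ y ∧ y' ∉ C := by
    by_contra! hno
    obtain ⟨w, hw⟩ := hCiso c₀ hc₀
    refine absurd (hcut y {v | v ≠ x ∧ v ≠ y ∧ v ∉ C} (by simp) ?_ ⟨d, ⟨hdx, hdy, hdC⟩, hd⟩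
      c₀ w hw) ?_
    · rintro a b ⟨hax, hay, haC⟩ hab
      by_contra! hb
      obtain ⟨hb, hby⟩ := hb
      by_cases hbx : b = x
      · exact haC (hno a (hbx ▸ hab.symm) hay)
      · have hbC : b ∈ C := by
          by_contra hbC
          exact hb ⟨hbx, hby, hbC⟩
        exact haC (hclosed b a hbC hab.symm hax hay)
    · rintro (h | ⟨hwx, hwy, hwC⟩)
      · exact h.2.2 hc₀
      · exact hwC (hclosed c₀ w hc₀ hw hwx hwy)
  obtain ⟨c, hcC, hcy⟩ : ∃ c ∈ C, G.Adj c y := by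
    by_contra! hno
    have hclC : ∀ a b, a ∈ C → G.Adj a b → b ∈ C ∨ b = x := by
      intro a b ha hab
      by_contra! hb
      exact hb.1 (hclosed a b ha hab hb.2 fun h => hno a ha (h ▸ hab))
    rcases hcut x C hCx hclC ⟨c₀, hc₀, hCiso c₀ hc₀⟩ x y hxy with h | h
    exacts [hCx h, hCy h]
  refine hCy (hmax (y := insert y C) ⟨y', hxy', ?_, ?_, hext y ⟨c, hcC, hcy⟩, ?_⟩
    (Set.subset_insert _ _) (Set.mem_insert _ _))
  · simp [hCx, hxy.ne]
  · simp [hy'y, hy'C]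
  · rintro e (rfl | he)
    exacts [⟨x, hxy.symm⟩, hCiso e he]

/-- A clique together with two disjoint connected sets, adjacent to each other and to all of the
clique, yields a clique minor. -/
theorem hasCliqueMinor_of_clique_of_two_sets {ι : Type*} [Fintype ι] {G : SimpleGraph W}
    {κ : ι → W} {B C : Set W} (hκ : Pairwise fun i j => G.Adj (κ i) (κ j))
    (hB : (G.induce B).Connected) (hC : (G.induce C).Connected) (hBC : Disjoint B C)
    (hκB : ∀ i, κ i ∉ B) (hκC : ∀ i, κ i ∉ C) (hadjB : ∀ i, ∃ b ∈ B, G.Adj (κ i) b)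
    (hadjC : ∀ i, ∃ c ∈ C, G.Adj (κ i) c) (hadj : ∃ b ∈ B, ∃ c ∈ C, G.Adj b c) :
    HasCliqueMinor G (Fintype.card ι + 2) := by
  let D : Option (Option ι) → Set W
    | none => B
    | some none => C
    | some (some i) => {κ i}
  have hD : ∀ i, (G.induce (D i)).Connected := by
    rintro (_ | _ | i)
    · exact hB
    · exact hC
    · exact induce_connected_iff.2 ⟨Set.singleton_nonempty _, fun A hA hne _ =>
        (Set.Nonempty.subset_singleton_iff hne).1 hA ▸ subset_rfl⟩
  have hdisj : Pairwise fun i j => Disjoint (D i) (D j) := by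
    rintro (_ | _ | i) (_ | _ | j) hij
    · exact absurd rfl hij
    · exact hBC
    · exact Set.disjoint_singleton_right.2 (hκB j)
    · exact hBC.symm
    · exact absurd rfl hij
    · exact Set.disjoint_singleton_right.2 (hκC j)
    · exact Set.disjoint_singleton_left.2 (hκB i)
    · exact Set.disjoint_singleton_left.2 (hκC i)
    · exact Set.disjoint_singleton.2 (hκ fun h => hij (by rw [h])).ne
  have hadjD : Pairwise fun i j => ∃ u ∈ D i, ∃ v ∈ D j, G.Adj u v := by
    rintro (_ | _ | i) (_ | _ | j) hij
    · exact absurd rfl hij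
    · exact hadj
    · obtain ⟨b, hb, h⟩ := hadjB j
      exact ⟨b, hb, _, rfl, h.symm⟩
    · obtain ⟨b, hb, c, hc, h⟩ := hadj
      exact ⟨c, hc, b, hb, h.symm⟩
    · exact absurd rfl hij
    · obtain ⟨c, hc, h⟩ := hadjC j
      exact ⟨c, hc, _, rfl, h.symm⟩
    · exact ⟨_, rfl, hadjB i⟩
    · exact ⟨_, rfl, hadjC i⟩
    · exact ⟨_, rfl, _, rfl, hκ fun h => hij (by rw [h])⟩
  let e : Fin (Fintype.card ι + 2) ≃ Option (Option ι) := Fintype.equivOfCardEq (by simp)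
  exact ⟨D ∘ e, fun i => Set.nonempty_coe_sort.1 (hD _).nonempty,
    fun i j hij => hdisj (e.injective.ne hij), fun i => hD _,
    fun i j hij => hadjD (e.injective.ne hij)⟩

section TotalGraph

variable {G : SimpleGraph V}

theorem totalGraph_adj_inl_inl {u v : V} :
    (totalGraph G).Adj (Sum.inl u) (Sum.inl v) ↔ G.Adj u v := by
  simp only [totalGraph, SimpleGraph.fromRel_adj, ne_eq, Sum.inl.injEq]
  exact ⟨fun h => h.2.elim id SimpleGraph.Adj.symm, fun h => ⟨h.ne, Or.inl h⟩⟩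

theorem totalGraph_adj_inl_inr {u : V} {e : G.edgeSet} :
    (totalGraph G).Adj (Sum.inl u) (Sum.inr e) ↔ u ∈ (e : Sym2 V) := by
  simp [totalGraph, SimpleGraph.fromRel_adj]

theorem totalGraph_adj_inr_inr_of_mem {u : V} {e f : G.edgeSet} (hef : e ≠ f)
    (he : u ∈ (e : Sym2 V)) (hf : u ∈ (f : Sym2 V)) :
    (totalGraph G).Adj (Sum.inr e) (Sum.inr f) := by
  simp only [totalGraph, SimpleGraph.fromRel_adj, ne_eq, Sum.inr.injEq]
  exact ⟨hef, Or.inl ⟨u, he, hf⟩⟩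

end TotalGraph

theorem exists_adj_ne_ne_of_three_le_degree [Fintype V] {G : SimpleGraph V} [DecidableRel G.Adj]
    {v : V} (hv : 3 ≤ G.degree v) (a b : V) : ∃ t, G.Adj v t ∧ t ≠ a ∧ t ≠ b := by
  classical
  have h : ({a, b} : Finset V).card < (G.neighborFinset v).card := by
    rw [SimpleGraph.card_neighborFinset_eq_degree]
    exact Finset.card_le_two.trans_lt hv
  obtain ⟨t, ht, hab⟩ := Finset.exists_mem_notMem_of_card_lt_card h
  simp only [Finset.mem_insert, Finset.mem_singleton, not_or] at hab
  exact ⟨t, by simpa using ht, hab⟩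

/-- If the non-isolated vertices have degree at least three and stay connected after deleting
the adjacent vertices `x` and `y`, then `x` and its edges are part of a clique minor of
`T(G)` with two more branch sets. -/
theorem totalGraph_hasCliqueMinor_of_induce_connected [Fintype V] {G : SimpleGraph V}
    [DecidableRel G.Adj] (hdeg : ∀ v w, G.Adj v w → 3 ≤ G.degree v) {x y : V} (hxy : G.Adj x y)
    (hconn : (G.induce {v | v ≠ x ∧ v ≠ y ∧ ∃ w, G.Adj v w}).Connected) :
    HasCliqueMinor (totalGraph G) (G.degree x + 3) := by
  classical
  set C := {v | v ≠ x ∧ v ≠ y ∧ ∃ w, G.Adj v w} with hCdef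
  have hmemC : ∀ {v w}, G.Adj v w → v ≠ x → v ≠ y → v ∈ C := fun h hx hy => ⟨hx, hy, _, h⟩
  have hother : ∀ {v w}, G.Adj v w → ∀ a b, ∃ t, G.Adj v t ∧ t ≠ a ∧ t ≠ b :=
    fun h => exists_adj_ne_ne_of_three_le_degree (hdeg _ _ h)
  obtain ⟨hCne, hCconn⟩ := induce_connected_iff.1 hconn
  obtain ⟨z, hyz, hzx, -⟩ := hother hxy.symm x x
  have hzC : z ∈ C := hmemC hyz.symm hzx hyz.ne'
  let κ : Option (G.neighborSet x) → V ⊕ G.edgeSet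
    | none => Sum.inl x
    | some w => Sum.inr ⟨s(x, w), w.2⟩
  let B₁ : Set (V ⊕ G.edgeSet) := insert (Sum.inr ⟨s(y, z), hyz⟩) (Sum.inl '' C)
  let B₂ : Set (V ⊕ G.edgeSet) :=
    insert (Sum.inl y) (Sum.inr '' {e | x ∉ (e : Sym2 V) ∧ (e : Sym2 V) ≠ s(y, z)})
  have hB₂ : ∀ {a b} (h : G.Adj a b), a ≠ x → b ≠ x → s(a, b) ≠ s(y, z) →
      (Sum.inr ⟨s(a, b), h⟩ : V ⊕ G.edgeSet) ∈ B₂ := by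
    intro a b h ha hb hne
    refine Or.inr ⟨_, ⟨?_, hne⟩, rfl⟩
    simp [ha.symm, hb.symm]
  have hconn₁ : ((totalGraph G).induce B₁).Connected := by
    refine induce_connected_iff.2 ⟨Set.insert_nonempty _ _, fun A hA hne hcl => ?_⟩
    have hAz : (Sum.inl '' C ∩ A).Nonempty := by
      obtain ⟨a, ha⟩ := hne
      rcases hA ha with rfl | haC
      · exact ⟨Sum.inl z, ⟨z, hzC, rfl⟩, hcl _ ha _ (Or.inr ⟨z, hzC, rfl⟩)
          (totalGraph_adj_inl_inr.2 (Sym2.mem_mk_right y z)).symm⟩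
      · exact ⟨a, haC, ha⟩
    obtain ⟨_, ⟨c, hcC, rfl⟩, hcA⟩ := hAz
    have hCA : C ⊆ {v | v ∈ C ∧ Sum.inl v ∈ A} :=
      hCconn _ (fun v hv => hv.1) ⟨c, hcC, hcA⟩ fun a ha b hb hab =>
        ⟨hb, hcl _ ha.2 _ (Or.inr ⟨b, hb, rfl⟩) (totalGraph_adj_inl_inl.2 hab)⟩
    rintro _ (rfl | ⟨v, hv, rfl⟩)
    · exact hcl _ (hCA hzC).2 _ (Or.inl rfl) (totalGraph_adj_inl_inr.2 (Sym2.mem_mk_right y z))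
    · exact (hCA hv).2
  have hconn₂ : ((totalGraph G).induce B₂).Connected := by
    refine induce_connected_iff.2 ⟨Set.insert_nonempty _ _, fun A hA hne hcl => ?_⟩
    have hstep : ∀ {u a b} (hua : G.Adj u a) (hub : G.Adj u b), Sum.inr ⟨s(u, a), hua⟩ ∈ A →
        u ≠ x → b ≠ x → s(u, b) ≠ s(y, z) → Sum.inr ⟨s(u, b), hub⟩ ∈ A := by
      intro u a b hua hub haA hux hbx hne
      by_cases hab : a = b
      · subst hab
        exact haA
      · refine hcl _ haA _ (hB₂ hub hux hbx hne) (totalGraph_adj_inr_inr_of_mem (u := u) ?_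
          (Sym2.mem_mk_left _ _) (Sym2.mem_mk_left _ _))
        intro h
        exact hab (Sym2.congr_right.1 (congrArg Subtype.val h))
    have hswap : ∀ {a b} (h : G.Adj a b), (Sum.inr ⟨s(a, b), h⟩ : V ⊕ G.edgeSet) =
        Sum.inr ⟨s(b, a), h.symm⟩ := by
      intro a b h
      congr 2
      exact Sym2.eq_swap
    have hnotmem : ∀ {a b}, a ≠ y → b ≠ y → s(a, b) ≠ s(y, z) := by
      intro a b ha hb h
      have : y ∈ s(a, b) := h ▸ Sym2.mem_mk_left y z
      rcases Sym2.mem_iff.1 this with rfl | rfl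
      exacts [ha rfl, hb rfl]
    have hfromy : ∀ {w} (hyw : G.Adj y w), w ≠ x → Sum.inr ⟨s(y, w), hyw⟩ ∈ A →
        ∃ v ∈ C, ∃ t ∈ C, ∃ h : G.Adj v t, Sum.inr ⟨s(v, t), h⟩ ∈ A := by
      intro w hyw hwx hA
      obtain ⟨t, hwt, htx, hty⟩ := hother hyw.symm x y
      refine ⟨w, hmemC hwt hwx hyw.ne', t, hmemC hwt.symm htx hty, hwt, ?_⟩
      exact hstep hyw.symm hwt (hswap hyw ▸ hA) hwx htx (hnotmem hyw.ne' hty)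
    obtain ⟨v₀, hv₀, t₀, ht₀, h₀, h₀A⟩ :
        ∃ v ∈ C, ∃ t ∈ C, ∃ h : G.Adj v t, Sum.inr ⟨s(v, t), h⟩ ∈ A := by
      obtain ⟨a, ha⟩ := hne
      rcases hA ha with rfl | ⟨⟨e, he⟩, ⟨hex, hne⟩, rfl⟩
      · obtain ⟨w, hyw, hwx, hwz⟩ := hother hyz x z
        exact hfromy hyw hwx (hcl _ ha _
          (hB₂ hyw hxy.ne' hwx fun h => hwz (Sym2.congr_right.1 h))
          (totalGraph_adj_inl_inr.2 (Sym2.mem_mk_left y w)))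
      · induction e with | _ a b
        have hab : G.Adj a b := he
        simp only [Sym2.mem_iff, not_or] at hex
        by_cases hay : a = y
        · subst hay
          exact hfromy hab (Ne.symm hex.2) ha
        by_cases hby : b = y
        · subst hby
          exact hfromy hab.symm (Ne.symm hex.1) (hswap hab ▸ ha)
        exact ⟨a, hmemC hab (Ne.symm hex.1) hay, b, hmemC hab.symm (Ne.symm hex.2) hby, hab, ha⟩
    have hCA : C ⊆ {v | v ∈ C ∧ ∃ t, ∃ h : G.Adj v t, Sum.inr ⟨s(v, t), h⟩ ∈ A} := by
      refine hCconn _ (fun v hv => hv.1) ⟨v₀, hv₀, t₀, h₀, h₀A⟩ ?_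
      rintro v ⟨hv, t, hvt, hvtA⟩ u hu hvu
      refine ⟨hu, v, hvu.symm, ?_⟩
      rw [hswap]
      exact hstep hvt hvu hvtA hv.1 hu.1 (hnotmem hv.2.1 hu.2.1)
    have hall : ∀ {v w} (h : G.Adj v w), v ∈ C → w ≠ x → s(v, w) ≠ s(y, z) →
        Sum.inr ⟨s(v, w), h⟩ ∈ A := by
      intro v w h hv hw hne
      obtain ⟨-, t, hvt, hvtA⟩ := hCA hv
      exact hstep hvt h hvtA hv.1 hw hne
    rintro _ (rfl | ⟨⟨e, he⟩, ⟨hex, hne⟩, rfl⟩)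
    · obtain ⟨w, hyw, hwx, hwz⟩ := hother hyz x z
      refine hcl _ (hall hyw.symm (hmemC hyw.symm hwx hyw.ne') hxy.ne' ?_) _ (Or.inl rfl)
        (totalGraph_adj_inl_inr.2 (Sym2.mem_mk_right w y)).symm
      rw [Sym2.eq_swap]
      exact fun h => hwz (Sym2.congr_right.1 h)
    · induction e with | _ a b
      have hab : G.Adj a b := he
      simp only [Sym2.mem_iff, not_or] at hex
      by_cases hay : a = y
      · subst hay
        have := hall hab.symm (hmemC hab.symm (Ne.symm hex.2) hab.ne') (Ne.symm hex.1)
          (by rwa [Sym2.eq_swap])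
        rwa [hswap] at this
      · exact hall hab (hmemC hab (Ne.symm hex.1) hay) (Ne.symm hex.2) hne
  have hcard : G.degree x + 3 = Fintype.card (Option (G.neighborSet x)) + 2 := by
    rw [Fintype.card_option, SimpleGraph.card_neighborSet_eq_degree]
  rw [hcard]
  have hedge : ∀ {u w a b : V} (h : G.Adj u w) (h' : G.Adj a b), u ∉ s(a, b) →
      w ∈ s(a, b) →
      (totalGraph G).Adj (Sum.inr ⟨s(u, w), h⟩) (Sum.inr ⟨s(a, b), h'⟩) := by
    intro u w a b h h' hu hw
    refine totalGraph_adj_inr_inr_of_mem (u := w) ?_ (Sym2.mem_mk_right _ _) hw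
    intro heq
    have heq : s(u, w) = s(a, b) := congrArg Subtype.val heq
    exact hu (heq ▸ Sym2.mem_mk_left _ _)
  have hxyz : x ∉ s(y, z) := by simp [hxy.ne, hzx.symm]
  refine hasCliqueMinor_of_clique_of_two_sets (κ := κ) (B := B₁) (C := B₂) ?_ hconn₁ hconn₂
    ?_ ?_ ?_ ?_ ?_ ⟨_, Or.inl rfl, _, Or.inl rfl,
      (totalGraph_adj_inl_inr.2 (Sym2.mem_mk_left y z)).symm⟩
  · rintro (_ | ⟨w, hw⟩) (_ | ⟨w', hw'⟩) hne
    · exact absurd rfl hne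
    · exact totalGraph_adj_inl_inr.2 (Sym2.mem_mk_left _ _)
    · exact (totalGraph_adj_inl_inr.2 (Sym2.mem_mk_left _ _)).symm
    · refine totalGraph_adj_inr_inr_of_mem (u := x) (fun h => hne ?_) (Sym2.mem_mk_left _ _)
        (Sym2.mem_mk_left _ _)
      have : w = w' := Sym2.congr_right.1 (congrArg Subtype.val h)
      subst this
      rfl
  · rw [Set.disjoint_left]
    rintro _ (rfl | ⟨v, hv, rfl⟩) (h | ⟨e, he, h⟩)
    · simp at h
    · exact he.2 (congrArg Subtype.val (Sum.inr_injective h))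
    · exact hv.2.1 (Sum.inl_injective h)
    · simp at h
  · rintro (_ | ⟨w, hw⟩) (h | ⟨e, he, h⟩)
    · simp [κ] at h
    · exact he.1 (Sum.inl_injective h)
    · have h : s(x, w) = s(y, z) := congrArg Subtype.val (Sum.inr_injective h)
      exact hxyz (h ▸ Sym2.mem_mk_left x w)
    · simp [κ] at h
  · rintro (_ | ⟨w, hw⟩) (h | ⟨e, he, h⟩)
    · exact hxy.ne (Sum.inl_injective h)
    · simp [κ] at h
    · simp [κ] at h
    · have h : (e : Sym2 V) = s(x, w) := congrArg Subtype.val (Sum.inr_injective h)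
      exact he.1 (h ▸ Sym2.mem_mk_left x w)
  · rintro (_ | ⟨w, hw : G.Adj x w⟩)
    · obtain ⟨w, hxw, hwy, -⟩ := hother hxy y y
      exact ⟨Sum.inl w, Or.inr ⟨w, hmemC hxw.symm hxw.ne' hwy, rfl⟩,
        totalGraph_adj_inl_inl.2 hxw⟩
    · by_cases hwy : w = y
      · subst hwy
        exact ⟨_, Or.inl rfl, hedge hw hyz hxyz (Sym2.mem_mk_left _ _)⟩
      · exact ⟨Sum.inl w, Or.inr ⟨w, hmemC hw.symm hw.ne' hwy, rfl⟩,
          (totalGraph_adj_inl_inr.2 (Sym2.mem_mk_right x w)).symm⟩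
  · rintro (_ | ⟨w, hw : G.Adj x w⟩)
    · exact ⟨Sum.inl y, Or.inl rfl, totalGraph_adj_inl_inl.2 hxy⟩
    · by_cases hwy : w = y
      · subst hwy
        exact ⟨Sum.inl w, Or.inl rfl, (totalGraph_adj_inl_inr.2 (Sym2.mem_mk_right x w)).symm⟩
      · obtain ⟨t, hwt, htx, hty⟩ := hother hw.symm x y
        refine ⟨_, hB₂ hwt hw.ne' htx ?_,
          hedge hw hwt (by simp [hw.ne, htx.symm]) (Sym2.mem_mk_left _ _)⟩
        intro h
        have : y ∈ s(w, t) := h ▸ Sym2.mem_mk_left y z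
        rcases Sym2.mem_iff.1 this with rfl | rfl
        exacts [hwy rfl, hty rfl]

end Minor

theorem mem_or_mem_of_not_totalColorable {V : Type*} [Fintype V] {H : SimpleGraph V}
    [DecidableRel H.Adj] {k : ℕ} (hk : H.maxDegree < k)
    (hdel : ∀ e ∈ H.edgeSet, TotalColorable (H.deleteEdges {e}) k) (hH : ¬TotalColorable H k)
    (x : V) (A : Set V) (hxA : x ∉ A) (hA : ∀ a b, a ∈ A → H.Adj a b → b ∈ A ∨ b = x)
    (hAne : ∃ a ∈ A, ∃ b, H.Adj a b) (a b : V) (hab : H.Adj a b) : a ∈ A ∨ b ∈ A := by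
  by_contra! hnot
  obtain ⟨c, hc, d, hcd⟩ := hAne
  have hsub : ∀ (e : Sym2 V) (S : Set (Sym2 V)), e ∈ H.edgeSet → e ∈ S →
      TotalColorable (H.deleteEdges S) k := by
    intro e S he heS
    obtain ⟨cv, ce, hcol⟩ := hdel e he
    exact ⟨cv, ce, hcol.mono
      (SimpleGraph.deleteEdges_anti (Set.singleton_subset_iff.2 heS)) le_rfl⟩
  refine hH (totalColorable_of_cut_vertex hxA hA ((H.degree_le_maxDegree x).trans_lt hk)
    (hsub s(a, b) _ hab ?_) (hsub s(c, d) _ hcd ⟨c, hc, Sym2.mem_mk_left c d⟩))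
  rintro ⟨e, he, hmem⟩
  rcases Sym2.mem_iff.1 hmem with rfl | rfl
  exacts [hnot.1 he, hnot.2 he]

/-- if `H` is `(Δ+3)`-total-critical (i.e. `χ''(H) = Δ(H) + 3` and
`χ''(H - e) ≤ Δ(H) + 2` for every edge `e`), then `T(H)` has a clique minor of
order `Δ(H) + 3`. -/
theorem totalGraph_hasCliqueMinor_of_totalCritical {V : Type*} [Fintype V]
    (H : SimpleGraph V) [DecidableRel H.Adj]
    (hchi : totalChromaticNumber H = H.maxDegree + 3)
    (hcrit : ∀ e ∈ H.edgeSet,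
      totalChromaticNumber (H.deleteEdges {e}) ≤ H.maxDegree + 2) :
    HasCliqueMinor (totalGraph H) (H.maxDegree + 3) := by
  have hH : ¬TotalColorable H (H.maxDegree + 2) := fun h => by
    have := h.totalChromaticNumber_le
    omega
  obtain ⟨l, cv, ce, hcol⟩ : ∃ l, TotalColorable H l := Nat.nonempty_of_sInf_eq_succ hchi
  have hdel : ∀ e ∈ H.edgeSet, TotalColorable (H.deleteEdges {e}) (H.maxDegree + 2) :=
    fun e he => TotalColorable.of_totalChromaticNumber_le
      ⟨cv, ce, IsTotalColoringBelow.mono hcol (SimpleGraph.deleteEdges_le _) le_rfl⟩ (hcrit e he)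
  have hle := H.degree_le_maxDegree
  have hpos : ∀ {u v}, H.Adj u v → 0 < H.degree u :=
    fun h => (H.degree_pos_iff_exists_adj _).2 ⟨_, h⟩
  have hlow : ∀ {u v}, H.Adj u v → 2 * H.degree u < H.maxDegree + 2 → 2 < H.degree u := by
    intro u v huv h
    by_contra! h2
    have := hle v
    exact hH (totalColorable_of_degree_add_le huv (hdel _ huv) (by omega) h)
  obtain ⟨u, v, huv⟩ : ∃ u v, H.Adj u v := by
    by_contra! hno
    exact hH ⟨fun _ => 0, fun _ => 0, ⟨fun u v h => (hno u v h).elim,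
      fun u v w h => (hno u v h).elim, fun u v h => (hno u v h).elim⟩, fun _ => by simp,
      fun _ _ => by simp⟩
  have h3 : 3 ≤ H.maxDegree := by
    by_contra! hlt
    have hu := hlow huv
    have hup := hpos huv
    have hleu := hle u
    have hmax : H.maxDegree = 2 := by omega
    obtain ⟨w, hw, hwv⟩ := Finset.exists_mem_ne (s := H.neighborFinset u)
      (by rw [SimpleGraph.card_neighborFinset_eq_degree]; omega) v
    rw [SimpleGraph.mem_neighborFinset] at hw
    rw [hmax] at hH hdel
    exact hH (totalColorable_four_of_degree_le_two (fun v => hmax ▸ hle v) huv hw hwv.symm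
      (hdel _ huv))
  have hdeg : ∀ v w, H.Adj v w → 3 ≤ H.degree v := by
    intro v w hvw
    by_contra! h
    have := hlow hvw (by omega)
    omega
  have : Nonempty V := ⟨u⟩
  obtain ⟨x, hx⟩ := H.exists_maximal_degree_vertex
  obtain ⟨y₁, hy₁, y₂, hy₂, hne⟩ := Finset.one_lt_card.1
    (show 1 < (H.neighborFinset x).card by
      rw [SimpleGraph.card_neighborFinset_eq_degree]; omega)
  rw [SimpleGraph.mem_neighborFinset] at hy₁ hy₂
  obtain ⟨y, hxy, hconn⟩ := exists_adj_induce_connected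
    (mem_or_mem_of_not_totalColorable (by omega) hdel hH) hy₁ hy₂ hne
  rw [hx]
  exact totalGraph_hasCliqueMinor_of_induce_connected hdeg hxy hconn
end
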